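/- Consider a leader-follower formation whose positions q_i(t) are obtained from a bearing persistently exciting formation p_i(t) by a similarity transformation, q_i(t) = c R(t) p_i(t) + d(t), with c > 0 a constant, R(t) ∈ SO(3), and d(t) ∈ ℝ³ (a relaxed bearing rigid formation). Assume all positions, velocities and bearings of the q-formation are well-defined and bounded, and that the q-formation is bearing persistently exciting. Then the observer p̂̇_i = v_i − K Σ_{j∈N_i} π_{g_ij(t)} (p̂_i − p̂_j) (with p̂_1 ≡ q_1, v_i = q̇_i, g_ij the bearings of the q-formation, and K positive definite) makes each error p̂_i − q_i converge to zero uniformly globally exponentially. -/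

import Mathlib

open Matrix MeasureTheory Real

noncomputable section

/-- Euclidean norm of a finite-dimensional real vector. -/
def euclNorm {ι : Type*} [Fintype ι] (x : ι → ℝ) : ℝ := Real.sqrt (∑ i, x i * x i)

/-- Projector onto the plane orthogonal to the unit vector `y`: `π_y = I₃ - y yᵀ`. -/
def proj (y : Fin 3 → ℝ) : Matrix (Fin 3) (Fin 3) ℝ := 1 - Matrix.vecMulVec y y

/-- A time-varying positive semidefinite matrix `Σ(t)` is persistently exciting (PE). -/
def IsPE {ι : Type*} [Fintype ι] [DecidableEq ι] (M : ℝ → Matrix ι ι ℝ) : Prop :=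
  ∃ T μ : ℝ, 0 < T ∧ 0 < μ ∧
    ∀ t : ℝ, 0 ≤ t →
      ((T⁻¹ • Matrix.of fun i j => ∫ τ in t..(t + T), M τ i j) -
        μ • (1 : Matrix ι ι ℝ)).PosSemidef

/-- Bearing of agent `j` relative to agent `i` computed from positions `p`. -/
def bearing {n : ℕ} (p : Fin n → ℝ → (Fin 3 → ℝ)) (i j : Fin n) (t : ℝ) : Fin 3 → ℝ :=
  (euclNorm (p j t - p i t))⁻¹ • (p j t - p i t)

/-- Leader-follower structure on `n` agents (agent `0` is the leader). -/
def LeaderFollower {n : ℕ} (N : Fin n → Finset (Fin n)) : Prop :=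
  (∀ i : Fin n, (i : ℕ) = 0 → N i = ∅) ∧
  (∀ i : Fin n, (i : ℕ) = 1 → N i = {⟨0, lt_of_le_of_lt (Nat.zero_le _) i.isLt⟩}) ∧
  (∀ i : Fin n, 2 ≤ (i : ℕ) → (N i).Nonempty ∧ ∀ j ∈ N i, (j : ℕ) < (i : ℕ))

/-- Membership in SO(3): orthogonal with determinant one. -/
def IsSO3 (R : Matrix (Fin 3) (Fin 3) ℝ) : Prop := Rᵀ * R = 1 ∧ R.det = 1

lemma psd_sq_le {E : Type*} [NormedAddCommGroup E] [InnerProductSpace ℝ E]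
    (S : E →L[ℝ] E) (s : ℝ) (hs : 0 < s) (hpos : ∀ x, 0 ≤ inner ℝ x (S x))
    (hsym : ∀ x y, inner ℝ (S x) y = inner ℝ x (S y)) (hb : ‖S‖ ≤ s) (x : E) :
    ‖S x‖ ^ 2 ≤ s * inner ℝ x (S x) := by
  have h1 := hpos (x - s⁻¹ • S x)
  have h2 : inner ℝ (S x) (S (S x)) ≤ s * ‖S x‖ ^ 2 := by
    calc inner ℝ (S x) (S (S x)) ≤ ‖S x‖ * ‖S (S x)‖ := real_inner_le_norm _ _
      _ ≤ ‖S x‖ * (s * ‖S x‖) := by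
        gcongr
        exact (S.le_opNorm _).trans (by gcongr)
      _ = _ := by ring
  have h3 : inner ℝ x (S (S x)) = ‖S x‖ ^ 2 := by
    rw [← hsym, real_inner_self_eq_norm_sq]
  have h4 : inner ℝ (S x) (S x) = ‖S x‖ ^ 2 := real_inner_self_eq_norm_sq _
  simp only [map_sub, map_smul, inner_sub_left, inner_sub_right, inner_smul_left,
    inner_smul_right, h3, h4] at h1
  simp only [conj_trivial] at h1
  have h5 : s⁻¹ * (s⁻¹ * inner ℝ (S x) (S (S x))) ≤ s⁻¹ * (s⁻¹ * (s * ‖S x‖ ^ 2)) := by gcongr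
  have h6 : s⁻¹ * (s⁻¹ * (s * ‖S x‖ ^ 2)) = s⁻¹ * ‖S x‖ ^ 2 := by field_simp
  have h7 : s⁻¹ * ‖S x‖ ^ 2 ≤ inner ℝ x (S x) := by linarith
  calc ‖S x‖ ^ 2 = s * (s⁻¹ * ‖S x‖ ^ 2) := by field_simp
    _ ≤ _ := by gcongr

/-- scalar inequality -/
lemma scalar_ineq (γ σ X Y U k' w κ μ T s D1 D2 D3 D4 : ℝ) (hμ : 0 < μ)
    (hσ : 0 ≤ σ)
    (hY : Y ^ 2 ≤ s * σ) (hγ : T + 2 * w ^ 2 * κ ^ 2 * s / μ ≤ 2 * γ) (hγ0 : 0 ≤ γ)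
    (h1 : D1 ≤ k' * (X * U)) 
    (h2 : -D2 ≤ w * X * (κ * Y + U)) (h3 : -D3 ≤ w * X * (κ * Y + U)) (h4 : μ * X ^ 2 ≤ D4) :
    γ * (-2 * σ + 2 * D1) - (D2 + D3 + D4 - T * σ) ≤
      - (μ / 4) * X ^ 2 + (4 / μ) * (γ * k' + w) ^ 2 * U ^ 2 := by
  have e1 : 2 * w * κ * X * Y ≤ μ / 2 * X ^ 2 + 2 * w ^ 2 * κ ^ 2 / μ * Y ^ 2 := by
    have : μ / 2 * X ^ 2 + 2 * w ^ 2 * κ ^ 2 / μ * Y ^ 2 - 2 * w * κ * X * Y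
      = (μ * X - 2 * w * κ * Y) ^ 2 / (2 * μ) := by field_simp; ring
    have : 0 ≤ (μ * X - 2 * w * κ * Y) ^ 2 / (2 * μ) := by positivity
    linarith
  have e2 : 2 * w ^ 2 * κ ^ 2 / μ * Y ^ 2 ≤ 2 * w ^ 2 * κ ^ 2 / μ * (s * σ) := by gcongr
  have e3 : (T + 2 * w ^ 2 * κ ^ 2 * s / μ) * σ ≤ 2 * γ * σ := by gcongr
  have e4 : 2 * (γ * k' + w) * (X * U) ≤ μ / 4 * X ^ 2 + (4 / μ) * (γ * k' + w) ^ 2 * U ^ 2 := by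
    have : μ / 4 * X ^ 2 + (4 / μ) * (γ * k' + w) ^ 2 * U ^ 2 - 2 * (γ * k' + w) * (X * U)
      = (μ * X - 4 * (γ * k' + w) * U) ^ 2 / (4 * μ) := by field_simp; ring
    have : 0 ≤ (μ * X - 4 * (γ * k' + w) * U) ^ 2 / (4 * μ) := by positivity
    linarith
  have e5 : γ * D1 ≤ γ * (k' * (X * U)) := by gcongr
  have e6 : 2 * w ^ 2 * κ ^ 2 / μ * (s * σ) = 2 * w ^ 2 * κ ^ 2 * s / μ * σ := by ring
  nlinarith

/-- comparison -/
lemma gron (L L' : ℝ → ℝ) (α lam D : ℝ) (hl : 0 < lam) (hα : α ≤ lam) (hD : 0 ≤ D)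
    (hL : ∀ t, 0 ≤ t → HasDerivAt L (L' t) t)
    (hle : ∀ t, 0 ≤ t → L' t ≤ -α * L t + D * exp (-2 * lam * t)) (t : ℝ) (ht : 0 ≤ t) :
    L t ≤ exp (-α * t) * (L 0 + D / lam) := by
  have hd : ∀ t, 0 ≤ t → HasDerivAt (fun t => exp (α * t) * L t + D / lam * exp (-lam * t))
      (exp (α * t) * (α * 1) * L t + exp (α * t) * L' t + D / lam * (exp (-lam * t) * (-lam * 1))) t := by
    intro t ht
    exact ((((hasDerivAt_id t).const_mul α).exp.mul (hL t ht))).add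
      ((((hasDerivAt_id t).const_mul (-lam)).exp).const_mul _)
  have hanti : AntitoneOn (fun t => exp (α * t) * L t + D / lam * exp (-lam * t)) (Set.Ici 0) := by
    apply antitoneOn_of_deriv_nonpos (convex_Ici 0)
    · exact fun t ht => (hd t ht).continuousAt.continuousWithinAt
    · intro t ht
      rw [interior_Ici] at ht
      exact (hd t (le_of_lt ht)).differentiableAt.differentiableWithinAt
    · intro t ht
      rw [interior_Ici] at ht
      have ht : 0 ≤ t := le_of_lt ht
      rw [(hd t ht).deriv]
      have h1 : exp (α * t) * L' t ≤ exp (α * t) * (-α * L t + D * exp (-2 * lam * t)) := by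
        gcongr; exact hle t ht
      have h2 : exp (α * t) * exp (-2 * lam * t) ≤ exp (-lam * t) := by
        rw [← exp_add]; apply exp_le_exp.mpr; nlinarith
      have h3 : D * (exp (α * t) * exp (-2 * lam * t)) ≤ D * exp (-lam * t) := by gcongr
      have h4 : D / lam * (exp (-lam * t) * (-lam * 1)) = - (D * exp (-lam * t)) := by field_simp
      rw [h4]
      nlinarith
  have h := hanti (Set.mem_Ici.2 le_rfl) (Set.mem_Ici.2 ht) ht
  simp only [mul_zero, exp_zero, one_mul, mul_one] at h
  have h5 : 0 ≤ D / lam * exp (-lam * t) := by positivity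
  have h6 : exp (-α * t) * (exp (α * t) * L t) = L t := by
    rw [← mul_assoc, ← exp_add]; simp
  rw [← h6]
  gcongr
  linarith

lemma main_ode {E : Type*} [NormedAddCommGroup E] [InnerProductSpace ℝ E] [CompleteSpace E]
    (S : ℝ → E →L[ℝ] E) (hcont : Continuous S) (s : ℝ) (hs : 0 < s)
    (hpos : ∀ t x, 0 ≤ inner ℝ x (S t x))
    (hsym : ∀ t x y, inner ℝ (S t x) y = inner ℝ x (S t y)) (hb : ∀ t, ‖S t‖ ≤ s)
    (T μ : ℝ) (hT : 0 < T) (hμ : 0 < μ)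
    (hPE : ∀ t, 0 ≤ t → ∀ x, μ * ‖x‖ ^ 2 ≤ inner ℝ x ((∫ τ in t..(t + T), S τ) x))
    (K Ki : E →L[ℝ] E) (hKi : ∀ x, Ki (K x) = x)
    (hKis : ∀ x y, inner ℝ (Ki x) y = inner ℝ x (Ki y))
    (m : ℝ) (hm : 0 < m) (hKip : ∀ x, m * ‖x‖ ^ 2 ≤ inner ℝ x (Ki x))
    (lam : ℝ) (hlam : 0 < lam) :
    ∃ k lam' : ℝ, 0 < k ∧ 0 < lam' ∧ lam' ≤ lam ∧ ∀ (x u : ℝ → E) (C : ℝ), 0 ≤ C →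
      (∀ t, 0 ≤ t → HasDerivAt x (-(K (S t (x t))) + u t) t) →
      (∀ t, 0 ≤ t → ‖u t‖ ≤ C * exp (-lam * t)) →
      ∀ t, 0 ≤ t → ‖x t‖ ≤ k * (‖x 0‖ + C) * exp (-lam' * t) := by
  -- the integrated excitation
  set A : ℝ → E →L[ℝ] E := fun t => ∫ τ in (0:ℝ)..t, S τ with hA
  have hAd : ∀ t, HasDerivAt A (S t) t := fun t => by
    exact intervalIntegral.integral_hasDerivAt_right (hcont.intervalIntegrable _ _)
      (hcont.stronglyMeasurableAtFilter _ _) hcont.continuousAt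
  have hAc : Continuous A := continuous_iff_continuousAt.2 fun t => (hAd t).continuousAt
  set B : ℝ → E →L[ℝ] E := fun t => ∫ τ in (0:ℝ)..t, A τ with hB
  have hBd : ∀ t, HasDerivAt B (A t) t := fun t => by
    exact intervalIntegral.integral_hasDerivAt_right (hAc.intervalIntegrable _ _)
      (hAc.stronglyMeasurableAtFilter _ _) hAc.continuousAt
  have hAsub : ∀ t t', A t' - A t = ∫ τ in t..t', S τ := fun t t' =>
    intervalIntegral.integral_interval_sub_left (hcont.intervalIntegrable _ _)
      (hcont.intervalIntegrable _ _)
  have hBsub : ∀ t t', B t' - B t = ∫ τ in t..t', A τ := fun t t' =>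
    intervalIntegral.integral_interval_sub_left (hAc.intervalIntegrable _ _)
      (hAc.intervalIntegrable _ _)
  set W : ℝ → E →L[ℝ] E := fun t => B (t + T) - B t - T • A t with hW
  have hWd : ∀ t, HasDerivAt W (A (t + T) - A t - T • S t) t := fun t =>
    (((hBd (t + T)).comp_add_const t T).sub (hBd t)).sub ((hAd t).const_smul T)
  set w : ℝ := s * T * T with hw
  have hw0 : 0 ≤ w := by positivity
  have hWb : ∀ t, ‖W t‖ ≤ w := by
    intro t
    have h1 : W t = ∫ τ in t..(t + T), (A τ - A t) := by
      rw [intervalIntegral.integral_sub (hAc.intervalIntegrable _ _) (by simp)]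
      simp [hW, hBsub]
    rw [h1]
    have h2 := intervalIntegral.norm_integral_le_of_norm_le_const (a := t) (b := t + T)
      (f := fun τ => A τ - A t) (C := s * T) ?_
    · simpa [abs_of_pos hT, hw] using h2
    · intro τ hτ
      rw [Set.uIoc_of_le (by linarith)] at hτ
      rw [hAsub]
      have h3 := intervalIntegral.norm_integral_le_of_norm_le_const (a := t) (b := τ)
        (f := S) (C := s) (fun _ _ => hb _)
      refine h3.trans ?_
      gcongr
      rw [abs_of_pos (by linarith [hτ.1])]
      linarith [hτ.2]
  set κ := ‖K‖
  set k' := ‖Ki‖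
  obtain ⟨γ, hγ0, hγ1, hγ2⟩ : ∃ γ : ℝ, 0 < γ ∧ T + 2 * w ^ 2 * κ ^ 2 * s / μ ≤ 2 * γ ∧
      w + 1 ≤ γ * m := by
    refine ⟨(T + 2 * w ^ 2 * κ ^ 2 * s / μ) + (w + 1) / m, by positivity, ?_, ?_⟩
    · have : 0 ≤ (T + 2 * w ^ 2 * κ ^ 2 * s / μ) := by positivity
      have : 0 ≤ (w + 1) / m := by positivity
      linarith
    · have : 0 ≤ (T + 2 * w ^ 2 * κ ^ 2 * s / μ) := by positivity
      rw [add_mul, div_mul_cancel₀ _ hm.ne']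
      nlinarith
  set β := γ * k' + w + 1 with hβ
  have hk'0 : 0 ≤ k' := norm_nonneg _
  have hβ0 : 0 < β := by positivity
  set α := min (μ / (4 * β)) lam with hα
  have hα0 : 0 < α := by positivity
  set c := (4 / μ) * (γ * k' + w) ^ 2 with hc
  have hc0 : 0 ≤ c := by positivity
  refine ⟨β + c / lam + 1, α / 2, by positivity, by positivity, ?_, ?_⟩
  · have : α ≤ lam := min_le_right _ _
    linarith
  intro x u C hC hx hu t ht
  set L : ℝ → ℝ := fun t => γ * inner ℝ (x t) (Ki (x t)) - inner ℝ (x t) (W t (x t)) with hL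
  have hWbd : ∀ t y z, |inner ℝ y (W t z)| ≤ w * ‖y‖ * ‖z‖ := by
    intro t y z
    calc |inner ℝ y (W t z)| ≤ ‖y‖ * ‖W t z‖ := abs_real_inner_le_norm _ _
      _ ≤ ‖y‖ * (w * ‖z‖) := by
        gcongr; exact ((W t).le_opNorm z).trans (by gcongr; exact hWb t)
      _ = _ := by ring
  have hKbd : ∀ y z, inner ℝ y (Ki z) ≤ k' * (‖y‖ * ‖z‖) := by
    intro y z
    calc inner ℝ y (Ki z) ≤ ‖y‖ * ‖Ki z‖ := real_inner_le_norm _ _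
      _ ≤ ‖y‖ * (k' * ‖z‖) := by
        gcongr; exact Ki.le_opNorm z
      _ = _ := by ring
  have hLlow : ∀ t, ‖x t‖ ^ 2 ≤ L t := by
    intro t
    have h1 := hKip (x t)
    have h2 := (abs_le.1 (hWbd t (x t) (x t))).2
    have h3 : γ * (m * ‖x t‖ ^ 2) ≤ γ * inner ℝ (x t) (Ki (x t)) := by gcongr
    have h4 : (w + 1) * ‖x t‖ ^ 2 ≤ (γ * m) * ‖x t‖ ^ 2 := by gcongr
    simp only [hL]
    nlinarith
  have hLup : ∀ t, L t ≤ β * ‖x t‖ ^ 2 := by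
    intro t
    have h1 := hKbd (x t) (x t)
    have h2 := (abs_le.1 (hWbd t (x t) (x t))).1
    have h3 : γ * inner ℝ (x t) (Ki (x t)) ≤ γ * (k' * (‖x t‖ * ‖x t‖)) := by gcongr
    simp only [hL, hβ]
    nlinarith [sq_nonneg ‖x t‖]
  have hgr := gron L _ α lam (c * C ^ 2) hlam (min_le_right _ _) (by positivity)
    (fun t ht => (((hx t ht).inner ℝ (Ki.hasFDerivAt.comp_hasDerivAt t (hx t ht))).const_mul γ).sub
      ((hx t ht).inner ℝ ((hWd t).clm_apply (hx t ht)))) ?_ t ht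
  · have h1 : ‖x t‖ ^ 2 ≤ ((β + c / lam + 1) * (‖x 0‖ + C) * exp (-(α / 2) * t)) ^ 2 := by
      have h2 : exp (-(α / 2) * t) ^ 2 = exp (-α * t) := by
        rw [← exp_nat_mul]; congr 1; push_cast; ring
      rw [mul_pow, h2]
      refine (hLlow t).trans (hgr.trans ?_)
      rw [mul_comm]
      gcongr
      have h3 := hLup 0
      have hx0 := norm_nonneg (x 0)
      have h4 : ‖x 0‖ ^ 2 ≤ (‖x 0‖ + C) ^ 2 := by gcongr; linarith
      have h5 : C ^ 2 ≤ (‖x 0‖ + C) ^ 2 := by gcongr; linarith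
      have h6 : 0 ≤ c / lam := by positivity
      calc L 0 + c * C ^ 2 / lam ≤ β * ‖x 0‖ ^ 2 + (c / lam) * C ^ 2 := by
            have : c * C ^ 2 / lam = (c / lam) * C ^ 2 := by ring
            linarith
        _ ≤ β * (‖x 0‖ + C) ^ 2 + (c / lam) * (‖x 0‖ + C) ^ 2 := by gcongr
        _ = (β + c / lam) * (‖x 0‖ + C) ^ 2 := by ring
        _ ≤ (β + c / lam + 1) ^ 2 * (‖x 0‖ + C) ^ 2 := by
            gcongr; nlinarith
        _ = _ := by ring
    exact le_of_sq_le_sq h1 (by positivity)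
  · intro t ht
    have hσ := hpos t (x t)
    have hY := psd_sq_le (S t) s hs (hpos t) (hsym t) (hb t) (x t)
    have hxd : ‖-(K (S t (x t))) + u t‖ ≤ κ * ‖S t (x t)‖ + ‖u t‖ := by
      refine (norm_add_le _ _).trans ?_
      rw [norm_neg]
      gcongr
      exact K.le_opNorm _
    have key := scalar_ineq γ (inner ℝ (x t) (S t (x t))) ‖x t‖ ‖S t (x t)‖ ‖u t‖ k' w κ μ T s
      (inner ℝ (x t) (Ki (u t)))
      (inner ℝ (x t) (W t (-(K (S t (x t))) + u t)))
      (inner ℝ (-(K (S t (x t))) + u t) (W t (x t)))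
      (inner ℝ (x t) ((A (t + T) - A t) (x t))) hμ hσ hY hγ1 hγ0.le (hKbd _ _)
      ((neg_le_abs _).trans ((hWbd _ _ _).trans (by gcongr)))
      ((neg_le_abs _).trans ((hWbd _ _ _).trans (by
        calc w * ‖-(K (S t (x t))) + u t‖ * ‖x t‖
            = w * ‖x t‖ * ‖-(K (S t (x t))) + u t‖ := by ring
          _ ≤ _ := by gcongr)))
      (by rw [hAsub]; exact hPE t ht _)
    have hU : ‖u t‖ ^ 2 ≤ C ^ 2 * exp (-2 * lam * t) := by
      have : exp (-2 * lam * t) = exp (-lam * t) ^ 2 := by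
        rw [← exp_nat_mul]; congr 1; push_cast; ring
      rw [this, ← mul_pow]
      gcongr
      exact hu t ht
    have h1 : c * ‖u t‖ ^ 2 ≤ c * (C ^ 2 * exp (-2 * lam * t)) := by gcongr
    have h2 : α * L t ≤ μ / 4 * ‖x t‖ ^ 2 := by
      calc α * L t ≤ α * (β * ‖x t‖ ^ 2) := by gcongr; exact hLup t
        _ ≤ (μ / (4 * β)) * (β * ‖x t‖ ^ 2) := by gcongr; exact min_le_left _ _
        _ = _ := by field_simp
    have e1 : inner ℝ (-(K (S t (x t))) + u t) (Ki (x t))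
        = -inner ℝ (x t) (S t (x t)) + inner ℝ (x t) (Ki (u t)) := by
      rw [real_inner_comm, hKis]
      simp [inner_add_right, hKi]
    have e2 : inner ℝ (x t) (Ki (-(K (S t (x t))) + u t))
        = -inner ℝ (x t) (S t (x t)) + inner ℝ (x t) (Ki (u t)) := by
      simp [inner_add_right, hKi]
    have e3 : inner ℝ (x t) ((A (t + T) - A t - T • S t) (x t))
      = inner ℝ (x t) ((A (t + T) - A t) (x t)) - T * inner ℝ (x t) (S t (x t)) := by
      rw [_root_.sub_apply _ (T • S t), inner_sub_right]
      simp [inner_smul_right]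
    refine le_trans (le_of_eq ?_) (key.trans (b := _) ?_)
    · rw [inner_add_right (x t), e3]
      simp only [Function.comp]
      rw [e1, e2]
      ring
    · rw [← hc]; linarith

abbrev EE := EuclideanSpace ℝ (Fin 3)

abbrev FF (A : Matrix (Fin 3) (Fin 3) ℝ) : EE →L[ℝ] EE := Matrix.toEuclideanCLM (n := Fin 3) (𝕜 := ℝ) A

lemma FF_sym (A : Matrix (Fin 3) (Fin 3) ℝ) (hA : Aᵀ = A) (x y : EE) :
    inner ℝ (FF A x) y = inner ℝ x (FF A y) := by
  rw [real_inner_comm, inner_toEuclideanCLM, inner_toEuclideanCLM, Matrix.dotProduct_mulVec,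
    dotProduct_comm]
  conv_rhs => rw [← hA, Matrix.mulVec_transpose]

lemma eucl_eq (x : Fin 3 → ℝ) : euclNorm x = ‖(WithLp.toLp 2 x : EE)‖ := by
  rw [EuclideanSpace.norm_eq]
  simp [euclNorm, sq]

lemma FF_cont : Continuous (fun A : Matrix (Fin 3) (Fin 3) ℝ => FF A) :=
  LinearMap.continuous_of_finiteDimensional
    ((Matrix.toEuclideanCLM (n := Fin 3) (𝕜 := ℝ)).toAlgEquiv.toLinearMap)

lemma FF_proj (y : Fin 3 → ℝ) (z : EE) :
    FF (proj y) z = z - (inner ℝ (WithLp.toLp 2 y : EE) z) • (WithLp.toLp 2 y : EE) := by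
  have : FF (proj y) z = WithLp.toLp 2 ((proj y) *ᵥ (WithLp.ofLp z)) := rfl
  rw [this]
  ext i
  simp [proj, Matrix.sub_mulVec, Matrix.vecMulVec_mulVec, PiLp.inner_apply, dotProduct, mul_comm]

lemma FF_proj_norm (y : Fin 3 → ℝ) (hy : euclNorm y ≤ 1) : ‖FF (proj y)‖ ≤ 2 := by
  rw [eucl_eq] at hy
  refine ContinuousLinearMap.opNorm_le_bound _ (by norm_num) fun z => ?_
  rw [FF_proj]
  refine (norm_sub_le _ _).trans ?_
  rw [norm_smul]
  have h1 : ‖inner ℝ (WithLp.toLp 2 y : EE) z‖ ≤ 1 * ‖z‖ :=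
    (norm_inner_le_norm _ _).trans (by gcongr)
  have h2 : ‖inner ℝ (WithLp.toLp 2 y : EE) z‖ * ‖(WithLp.toLp 2 y : EE)‖ ≤ (1 * ‖z‖) * 1 := by
    gcongr
  linarith

lemma FF_proj_pos (y : Fin 3 → ℝ) (hy : euclNorm y ≤ 1) (z : EE) :
    0 ≤ inner ℝ z (FF (proj y) z) := by
  rw [eucl_eq] at hy
  rw [FF_proj, inner_sub_right, inner_smul_right, real_inner_self_eq_norm_sq, real_inner_comm]
  have h1 : |inner ℝ z (WithLp.toLp 2 y : EE)| ≤ ‖z‖ * 1 :=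
    (abs_real_inner_le_norm _ _).trans (by gcongr)
  have := sq_le_sq' (abs_le.1 h1).1 (abs_le.1 h1).2
  rw [real_inner_comm] at this ⊢
  nlinarith

lemma proj_transpose (y : Fin 3 → ℝ) : (proj y)ᵀ = proj y := by
  simp [proj, Matrix.transpose_vecMulVec]

lemma bearing_norm {n : ℕ} (q : Fin n → ℝ → (Fin 3 → ℝ)) (i j : Fin n) (t : ℝ) :
    euclNorm (bearing q i j t) ≤ 1 := by
  rw [eucl_eq, bearing, eucl_eq, WithLp.toLp_smul, norm_smul, norm_inv, norm_norm]
  exact inv_mul_le_one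

lemma proj_bearing_cancel {n : ℕ} (q : Fin n → ℝ → (Fin 3 → ℝ)) (i j : Fin n) (t : ℝ)
    (h : q i t ≠ q j t) :
    (proj (bearing q i j t)) *ᵥ (q i t) = (proj (bearing q i j t)) *ᵥ (q j t) := by
  have h1 : FF (proj (bearing q i j t)) (WithLp.toLp 2 (q j t - q i t)) = 0 := by
    have hne : ‖(WithLp.toLp 2 (q j t - q i t) : EE)‖ ≠ 0 := by
      rw [norm_ne_zero_iff]
      simpa [sub_eq_zero] using h.symm
    rw [FF_proj, bearing, eucl_eq, WithLp.toLp_smul, inner_smul_left, real_inner_self_eq_norm_sq,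
      smul_smul, sub_eq_zero]
    simp only [conj_trivial]
    have : ‖(WithLp.toLp 2 (q j t - q i t) : EE)‖⁻¹ * ‖(WithLp.toLp 2 (q j t - q i t) : EE)‖ ^ 2 *
      ‖(WithLp.toLp 2 (q j t - q i t) : EE)‖⁻¹ = 1 := by field_simp
    rw [this, one_smul]
  rw [toEuclideanCLM_toLp] at h1
  have h2 : (proj (bearing q i j t)) *ᵥ (q j t - q i t) = 0 := by
    simpa using h1
  rw [Matrix.mulVec_sub, sub_eq_zero] at h2
  exact h2.symm

lemma bearing_cont {n : ℕ} (q v : Fin n → ℝ → (Fin 3 → ℝ)) (i j : Fin n)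
    (hderiv : ∀ i, ∀ t : ℝ, 0 ≤ t → HasDerivAt (q i) (v i t) t)
    (h : ∀ t : ℝ, 0 ≤ t → q i t ≠ q j t) :
    Continuous fun t => bearing q i j (max t 0) := by
  have hq : ∀ i, Continuous fun t => q i (max t 0) := fun i => by
    rw [continuous_iff_continuousAt]
    intro t
    exact ContinuousAt.comp (f := fun t : ℝ => max t 0)
      ((hderiv i _ (le_max_right t 0)).continuousAt) (by fun_prop)
  have hs : Continuous fun t => q j (max t 0) - q i (max t 0) := (hq j).sub (hq i)
  have hn : Continuous fun t => euclNorm (q j (max t 0) - q i (max t 0)) := by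
    simp only [eucl_eq]
    exact ((PiLp.continuous_toLp 2 _).comp hs).norm
  refine Continuous.smul (hn.inv₀ fun t => ?_) hs
  rw [eucl_eq, norm_ne_zero_iff]
  simpa [sub_eq_zero] using (h _ (le_max_right t 0)).symm

lemma proj_cont : Continuous proj := by
  unfold proj
  exact continuous_const.sub (continuous_id.matrix_vecMulVec continuous_id)

lemma PE_FF (M : ℝ → Matrix (Fin 3) (Fin 3) ℝ) (hM : Continuous M) (T μ t : ℝ) (hT : 0 < T)
    (h : ((T⁻¹ • Matrix.of fun i j => ∫ τ in t..(t + T), M τ i j) -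
        μ • (1 : Matrix (Fin 3) (Fin 3) ℝ)).PosSemidef) (x : EE) :
    (T * μ) * ‖x‖ ^ 2 ≤ inner ℝ x ((∫ τ in t..(t + T), FF (M τ)) x) := by
  have hF : Continuous fun τ => FF (M τ) := FF_cont.comp hM
  have h0 : (∫ τ in t..(t + T), FF (M τ)) =
      FF (Matrix.of fun i j => ∫ τ in t..(t + T), M τ i j) := by
    ext z i
    have e1 : (∫ τ in t..(t + T), FF (M τ)) z = ∫ τ in t..(t + T), FF (M τ) z :=
      ContinuousLinearMap.intervalIntegral_apply (hF.intervalIntegrable _ _) z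
    have hFz : Continuous fun τ => FF (M τ) z := by fun_prop
    have e2 := ContinuousLinearMap.intervalIntegral_comp_comm
      (EuclideanSpace.proj (𝕜 := ℝ) i : EE →L[ℝ] ℝ) (hFz.intervalIntegrable (μ := volume) t (t + T))
    rw [e1]
    refine e2.symm.trans ?_
    change (∫ τ in t..(t + T), (FF (M τ) z) i) = _
    have e3 : ∀ A : Matrix (Fin 3) (Fin 3) ℝ, (FF A z) i = ∑ j, A i j * z j := fun A => rfl
    simp only [e3, Matrix.of_apply]
    rw [intervalIntegral.integral_finset_sum]
    · simp
    · intro j _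
      have : Continuous fun τ => M τ i j := hM.matrix_elem i j
      exact (this.mul continuous_const).intervalIntegrable _ _
  rw [h0, inner_toEuclideanCLM]
  have h1 := h.dotProduct_mulVec_nonneg (WithLp.ofLp x)
  rw [Matrix.sub_mulVec, Matrix.smul_mulVec, Matrix.smul_mulVec, dotProduct_sub,
    dotProduct_smul, dotProduct_smul, Matrix.one_mulVec] at h1
  have h2 : (WithLp.ofLp x) ⬝ᵥ (WithLp.ofLp x) = ‖x‖ ^ 2 := by
    rw [EuclideanSpace.norm_sq_eq]; simp [dotProduct, sq]
  simp only [star_trivial, smul_eq_mul, h2] at h1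
  have h3 : T * (μ * ‖x‖ ^ 2) ≤ T * (T⁻¹ * (WithLp.ofLp x ⬝ᵥ
    (Matrix.of fun i j => ∫ τ in t..(t + T), M τ i j) *ᵥ (WithLp.ofLp x))) := by
    exact mul_le_mul_of_nonneg_left (by linarith) hT.le
  rw [← mul_assoc T T⁻¹, mul_inv_cancel₀ hT.ne', one_mul] at h3
  linarith

lemma agent {n : ℕ} (N : Fin n → Finset (Fin n)) (q v : Fin n → ℝ → (Fin 3 → ℝ))
    (hderiv : ∀ i, ∀ t : ℝ, 0 ≤ t → HasDerivAt (q i) (v i t) t)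
    (hqwell : ∀ i, ∀ j ∈ N i, ∀ t : ℝ, 0 ≤ t → q i t ≠ q j t) (i : Fin n)
    (hPE : IsPE (fun t => ∑ j ∈ N i, proj (bearing q i j t)))
    (K : Matrix (Fin 3) (Fin 3) ℝ) (hK : K.PosDef) (lam : ℝ) (hlam : 0 < lam) :
    ∃ k lam' : ℝ, 0 < k ∧ 0 < lam' ∧ lam' ≤ lam ∧ ∀ (x u : ℝ → EE) (C : ℝ), 0 ≤ C →
      (∀ t, 0 ≤ t → HasDerivAt x
        (-(FF K (FF (∑ j ∈ N i, proj (bearing q i j t)) (x t))) + u t) t) →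
      (∀ t, 0 ≤ t → ‖u t‖ ≤ C * exp (-lam * t)) →
      ∀ t, 0 ≤ t → ‖x t‖ ≤ k * (‖x 0‖ + C) * exp (-lam' * t) := by
  obtain ⟨T, μ, hT, hμ, hPE⟩ := hPE
  set M : ℝ → Matrix (Fin 3) (Fin 3) ℝ := fun t => ∑ j ∈ N i, proj (bearing q i j (max t 0)) with hM
  have hMc : Continuous M := continuous_finsetSum _ fun j hj =>
    proj_cont.comp (bearing_cont q v i j hderiv (hqwell i j hj))
  have hMe : ∀ t, 0 ≤ t → M t = ∑ j ∈ N i, proj (bearing q i j t) := fun t ht => by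
    simp only [hM, max_eq_left ht]
  have hFM : ∀ t, FF (M t) = ∑ j ∈ N i, FF (proj (bearing q i j (max t 0))) := fun t => by
    simp only [hM, FF, map_sum]
  have hKt : Kᵀ = K := by simpa [Matrix.IsHermitian] using hK.isHermitian
  have hdet : IsUnit K.det := (Matrix.isUnit_iff_isUnit_det _).1 hK.isUnit
  have hKi1 : ∀ x, FF K⁻¹ (FF K x) = x := fun x => by
    rw [← mul_apply_eq_comp, ← map_mul, Matrix.nonsing_inv_mul _ hdet]; simp
  have hKi2 : ∀ x, FF K (FF K⁻¹ x) = x := fun x => by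
    rw [← mul_apply_eq_comp, ← map_mul, Matrix.mul_nonsing_inv _ hdet]; simp
  have hm : 0 < ‖FF K‖ + 1 := by positivity
  have c1 : ∀ t x, 0 ≤ inner ℝ x (FF (M t) x) := by
    intro t x
    rw [hFM, ContinuousLinearMap.sum_apply, inner_sum]
    exact Finset.sum_nonneg fun j _ => FF_proj_pos _ (bearing_norm _ _ _ _) _
  have c2 : ∀ t x y, inner ℝ (FF (M t) x) y = inner ℝ x (FF (M t) y) := by
    intro t
    exact FF_sym _ (by simp [hM, Matrix.transpose_sum, proj_transpose])
  have c3 : ∀ t, ‖FF (M t)‖ ≤ 2 * (N i).card + 1 := by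
    intro t
    rw [hFM]
    refine (norm_sum_le_of_le _ (fun j _ => FF_proj_norm _ (bearing_norm _ _ _ _))).trans ?_
    simp only [Finset.sum_const, nsmul_eq_mul]
    linarith
  have c4 : ∀ t, 0 ≤ t → ∀ x, T * μ * ‖x‖ ^ 2 ≤ inner ℝ x ((∫ τ in t..(t + T), FF (M τ)) x) := by
    intro t ht x
    refine PE_FF M hMc T μ t hT ?_ x
    have hh := hPE t ht
    have e : (Matrix.of fun a b => ∫ τ in t..(t + T), M τ a b) =
        Matrix.of fun a b => ∫ τ in t..(t + T), (∑ j ∈ N i, proj (bearing q i j τ)) a b := by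
      ext a b
      simp only [Matrix.of_apply]
      apply intervalIntegral.integral_congr
      intro τ hτ
      rw [Set.uIcc_of_le (by linarith)] at hτ
      simp only [hMe τ (ht.trans hτ.1)]
    rw [e]
    exact hh
  have c5 : ∀ x, (‖FF K‖ + 1)⁻¹ * ‖x‖ ^ 2 ≤ inner ℝ x (FF K⁻¹ x) := by
    intro x
    have h := psd_sq_le (FF K) (‖FF K‖ + 1) hm (fun y => by
      rw [inner_toEuclideanCLM]; simpa using hK.posSemidef.dotProduct_mulVec_nonneg _)
      (FF_sym _ hKt) (by linarith) (FF K⁻¹ x)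
    rw [hKi2, real_inner_comm] at h
    rw [inv_mul_le_iff₀ hm]
    exact h
  obtain ⟨k, lam', h1, h2, h3, h4⟩ := main_ode (fun t => FF (M t)) (FF_cont.comp hMc)
    (2 * (N i).card + 1) (by positivity) c1 c2 c3 T (T * μ) hT (by positivity) c4 (FF K) (FF K⁻¹)
    hKi1 (FF_sym _ (by rw [Matrix.transpose_nonsing_inv, hKt])) (‖FF K‖ + 1)⁻¹ (by positivity)
    c5 lam hlam
  refine ⟨k, lam', h1, h2, h3, fun x u C hC hx hu => h4 x u C hC (fun t ht => ?_) hu⟩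
  simp only [hMe t ht]
  exact hx t ht

/-- relaxed bearing rigid formation. If the positions `q_i(t)` are obtained
from a bearing-PE formation `p_i(t)` by a time-varying similarity transformation
`q_i(t) = c R(t) p_i(t) + d(t)` and the `q`-formation is itself bearing PE with bounded,
well-defined positions, velocities, and bearings, then the observer
`p̂̇_i = v_i − K Σ_{j∈N_i} π_{g_ij}(p̂_i − p̂_j)`, `p̂_1 ≡ q_1`, makes every error
`p̂_i − q_i` converge to zero uniformly globally exponentially. -/
theorem stmt3
    (n : ℕ) (hn : 2 ≤ n) (N : Fin n → Finset (Fin n)) (hLF : LeaderFollower N)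
    (p q v : Fin n → ℝ → (Fin 3 → ℝ))
    (c : ℝ) (hc : 0 < c) (R : ℝ → Matrix (Fin 3) (Fin 3) ℝ) (d : ℝ → (Fin 3 → ℝ))
    (hR : ∀ t : ℝ, IsSO3 (R t))
    (hsim : ∀ i, ∀ t : ℝ, q i t = c • (R t).mulVec (p i t) + d t)
    (hpwell : ∀ i, ∀ j ∈ N i, ∀ t : ℝ, 0 ≤ t → p i t ≠ p j t)
    (hpPE : ∀ i : Fin n, (i : ℕ) ≠ 0 →
      IsPE (fun t => ∑ j ∈ N i, proj (bearing p i j t)))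
    (hderiv : ∀ i, ∀ t : ℝ, 0 ≤ t → HasDerivAt (q i) (v i t) t)
    (hbounded : ∃ M : ℝ, ∀ i, ∀ t : ℝ, 0 ≤ t → euclNorm (q i t) ≤ M ∧ euclNorm (v i t) ≤ M)
    (hqwell : ∀ i, ∀ j ∈ N i, ∀ t : ℝ, 0 ≤ t → q i t ≠ q j t)
    (hqPE : ∀ i : Fin n, (i : ℕ) ≠ 0 →
      IsPE (fun t => ∑ j ∈ N i, proj (bearing q i j t)))
    (K : Matrix (Fin 3) (Fin 3) ℝ) (hK : K.PosDef) :
    ∃ k lam : ℝ, 0 < k ∧ 0 < lam ∧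
      ∀ phat : Fin n → ℝ → (Fin 3 → ℝ),
        (∀ t : ℝ, 0 ≤ t → ∀ i : Fin n, (i : ℕ) = 0 → phat i t = q i t) →
        (∀ i : Fin n, (i : ℕ) ≠ 0 → ∀ t : ℝ, 0 ≤ t →
          HasDerivAt (phat i)
            (v i t - K.mulVec ((∑ j ∈ N i, proj (bearing q i j t)).mulVec
              (phat i t) - ∑ j ∈ N i, (proj (bearing q i j t)).mulVec (phat j t))) t) →
        ∀ i : Fin n, (i : ℕ) ≠ 0 → ∀ t : ℝ, 0 ≤ t →
          euclNorm (phat i t - q i t) ≤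
            k * (∑ j ∈ Finset.univ.filter (fun j : Fin n => (j : ℕ) ≠ 0),
              euclNorm (phat j 0 - q j 0)) * Real.exp (-lam * t) := by
  have hlt : ∀ i : Fin n, ∀ j ∈ N i, (j : ℕ) < i := by
    intro i j hj
    obtain ⟨h0, h1, h2⟩ := hLF
    rcases Nat.lt_or_ge (i : ℕ) 2 with h | h
    · rcases Nat.lt_or_ge (i : ℕ) 1 with h' | h'
      · rw [h0 i (by omega)] at hj
        simp at hj
      · rw [h1 i (by omega)] at hj
        rw [Finset.mem_singleton.1 hj]
        exact h'
    · exact (h2 i h).2 j hj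
  have main : ∀ m : ℕ, ∃ k lam : ℝ, 0 < k ∧ 0 < lam ∧
      ∀ phat : Fin n → ℝ → (Fin 3 → ℝ),
        (∀ t : ℝ, 0 ≤ t → ∀ i : Fin n, (i : ℕ) = 0 → phat i t = q i t) →
        (∀ i : Fin n, (i : ℕ) ≠ 0 → ∀ t : ℝ, 0 ≤ t →
          HasDerivAt (phat i)
            (v i t - K.mulVec ((∑ j ∈ N i, proj (bearing q i j t)).mulVec
              (phat i t) - ∑ j ∈ N i, (proj (bearing q i j t)).mulVec (phat j t))) t) →
        ∀ i : Fin n, (i : ℕ) < m → ∀ t : ℝ, 0 ≤ t →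
          euclNorm (phat i t - q i t) ≤
            k * (∑ j ∈ Finset.univ.filter (fun j : Fin n => (j : ℕ) ≠ 0),
              euclNorm (phat j 0 - q j 0)) * Real.exp (-lam * t) := by
    intro m
    induction m with
    | zero => exact ⟨1, 1, one_pos, one_pos, fun _ _ _ i hi => absurd hi (by omega)⟩
    | succ m ih =>
      obtain ⟨k, lam, hk, hlam, ih⟩ := ih
      by_cases hm : m < n ∧ m ≠ 0
      · obtain ⟨hmn, hm0⟩ := hm
        set i : Fin n := ⟨m, hmn⟩ with hi
        have hi0 : (i : ℕ) ≠ 0 := hm0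
        obtain ⟨k1, lam1, hk1, hlam1, hle, hag⟩ :=
          agent N q v hderiv hqwell i (hqPE i hi0) K hK lam hlam
        set D : ℝ := ‖FF K‖ * ((N i).card * (2 * k)) with hD
        have hD0 : 0 ≤ D := by positivity
        refine ⟨k + k1 * (1 + D), lam1, by positivity, hlam1, ?_⟩
        intro phat hp0 hpd a ha t ht
        set Z0 := ∑ j ∈ Finset.univ.filter (fun j : Fin n => (j : ℕ) ≠ 0),
              euclNorm (phat j 0 - q j 0) with hZ
        have hZ0 : 0 ≤ Z0 := Finset.sum_nonneg fun j _ => Real.sqrt_nonneg _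
        by_cases ham : (a : ℕ) < m
        · refine (ih phat hp0 hpd a ham t ht).trans ?_
          have hexp : exp (-lam * t) ≤ exp (-lam1 * t) := exp_le_exp.2 (by nlinarith)
          have : 0 ≤ k1 * (1 + D) := by positivity
          gcongr
          linarith
        · have hai : a = i := Fin.ext (by simp only [hi]; omega)
          rw [hai]
          have hini : ‖(WithLp.toLp 2 (phat i 0 - q i 0) : EE)‖ ≤ Z0 := by
            rw [← eucl_eq]
            exact Finset.single_le_sum (f := fun j => euclNorm (phat j 0 - q j 0))
              (fun j _ => Real.sqrt_nonneg _) (by simpa using hi0)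
          have hfin := hag (fun t => WithLp.toLp 2 (phat i t - q i t))
            (fun t => FF K (∑ j ∈ N i, FF (proj (bearing q i j t))
              (WithLp.toLp 2 (phat j t - q j t)))) (D * Z0) (by positivity) ?_ ?_ t ht
          · rw [eucl_eq]
            refine hfin.trans ?_
            refine mul_le_mul_of_nonneg_right ?_ (exp_pos _).le
            calc k1 * (‖(WithLp.toLp 2 (phat i 0 - q i 0) : EE)‖ + D * Z0)
                ≤ k1 * (Z0 + D * Z0) := by gcongr
              _ = k1 * (1 + D) * Z0 := by ring
              _ ≤ _ := mul_le_mul_of_nonneg_right (by linarith) hZ0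
          · intro t ht
            have h1 := (hpd i hi0 t ht).sub (hderiv i t ht)
            have h2 := (PiLp.hasFDerivAt_toLp (𝕜 := ℝ) 2 (phat i t - q i t)).comp_hasDerivAt t h1
            refine h2.congr_deriv ?_
            have hc : ∑ j ∈ N i, (proj (bearing q i j t)) *ᵥ (q j t)
                = (∑ j ∈ N i, proj (bearing q i j t)) *ᵥ (q i t) := by
              rw [Matrix.sum_mulVec]
              exact Finset.sum_congr rfl fun j hj =>
                (proj_bearing_cancel q i j t (hqwell i j hj t ht)).symm
            simp only [toEuclideanCLM_toLp]
            rw [← WithLp.toLp_sum, toEuclideanCLM_toLp, ← WithLp.toLp_neg, ← WithLp.toLp_add]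
            change WithLp.toLp 2 _ = _
            congr 1
            simp only [Matrix.mulVec_sub, Finset.sum_sub_distrib, hc]
            abel
          · intro t ht
            refine ((FF K).le_opNorm _).trans ?_
            rw [hD, mul_assoc, mul_assoc]
            gcongr
            refine (norm_sum_le_of_le _ (fun j hj => ?_) (n := fun _ => 2 * (k * Z0 * exp (-lam * t)))).trans ?_
            · refine ((FF _).le_opNorm _).trans ?_
              gcongr
              · exact FF_proj_norm _ (bearing_norm _ _ _ _)
              · rw [← eucl_eq]
                exact ih phat hp0 hpd j (hlt _ _ hj) t ht
            · simp only [Finset.sum_const, nsmul_eq_mul]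
              apply le_of_eq; ring
      · refine ⟨k, lam, hk, hlam, ?_⟩
        intro phat hp0 hpd a ha t ht
        by_cases ha0 : (a : ℕ) = 0
        · rw [hp0 t ht a ha0, sub_self]
          have : euclNorm (0 : Fin 3 → ℝ) = 0 := by simp [euclNorm]
          rw [this]
          have hZ0 : 0 ≤ ∑ j ∈ Finset.univ.filter (fun j : Fin n => (j : ℕ) ≠ 0),
              euclNorm (phat j 0 - q j 0) := Finset.sum_nonneg fun j _ => Real.sqrt_nonneg _
          positivity
        · exact ih phat hp0 hpd a (by have := a.isLt; omega) t ht
  obtain ⟨k, lam, hk, hlam, h⟩ := main n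
  exact ⟨k, lam, hk, hlam, fun phat h0 hd i _ t ht => h phat h0 hd i i.isLt t ht⟩
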